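/- For every θ ∈ (0,1) there exists a constant C > 0 (depending only on θ) such that for every θ-Hölder continuous function f : [0,1] → ℝ and every γ ∈ (0,1], one has ‖f‖_{∞,[0,1]} ≤ C ( γ ‖f‖_θ + γ^{−1/θ} ∫_0^1 |f(t)| dt ). -/

import Mathlib

open MeasureTheory

theorem continuousOn_of_abs_sub_le_mul_rpow {f : ℝ → ℝ} {S : Set ℝ} {H θ : ℝ} (hθ : 0 < θ)
    (h : ∀ s ∈ S, ∀ t ∈ S, |f t - f s| ≤ H * |t - s| ^ θ) : ContinuousOn f S := by
  intro x hx
  rw [ContinuousWithinAt, tendsto_iff_dist_tendsto_zero]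
  have hlim : Filter.Tendsto (fun t => H * |t - x| ^ θ) (nhdsWithin x S) (nhds 0) := by
    have hc : Continuous fun t : ℝ => H * |t - x| ^ θ :=
      continuous_const.mul
        ((continuous_id.sub continuous_const).abs.rpow_const fun _ => Or.inr hθ.le)
    simpa [Real.zero_rpow hθ.ne'] using (hc.tendsto x).mono_left nhdsWithin_le_nhds
  refine squeeze_zero' (Filter.Eventually.of_forall fun _ => dist_nonneg) ?_ hlim
  filter_upwards [self_mem_nhdsWithin] with t ht
  exact h x hx t ht

/-- A point value is controlled by the oscillation at scale `δ` and the average of the absolute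
value over an interval of length `δ` containing the point. -/
theorem mul_abs_le_of_abs_sub_le_mul_rpow {f : ℝ → ℝ} {H θ δ x : ℝ} (hθ : 0 < θ)
    (h : ∀ s ∈ Set.Icc (0 : ℝ) 1, ∀ t ∈ Set.Icc (0 : ℝ) 1, |f t - f s| ≤ H * |t - s| ^ θ)
    (hδ : δ ∈ Set.Ioc (0 : ℝ) 1) (hx : x ∈ Set.Icc (0 : ℝ) 1) :
    δ * |f x| ≤ δ * (H * δ ^ θ) + ∫ t in (0 : ℝ)..1, |f t| := by
  obtain ⟨hδ0, hδ1⟩ := hδ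
  obtain ⟨hx0, hx1⟩ := hx
  have hH : 0 ≤ H := by
    have := h 0 (by simp) 1 (by simp)
    simp only [sub_zero, abs_one, Real.one_rpow, mul_one] at this
    exact (abs_nonneg _).trans this
  have hcont : ContinuousOn (fun t => |f t|) (Set.Icc 0 1) :=
    (continuousOn_of_abs_sub_le_mul_rpow hθ h).abs
  have hint : IntervalIntegrable (fun t => |f t|) volume 0 1 :=
    hcont.intervalIntegrable_of_Icc zero_le_one
  set a := x * (1 - δ) with ha
  have ha0 : 0 ≤ a := mul_nonneg hx0 (by linarith)
  have hax : a ≤ x := by nlinarith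
  have hxa : x ≤ a + δ := by nlinarith
  have ha1 : a + δ ≤ 1 := by nlinarith
  have hsub : Set.Icc a (a + δ) ⊆ Set.Icc 0 1 := Set.Icc_subset_Icc ha0 ha1
  have hint' : IntervalIntegrable (fun t => |f t|) volume a (a + δ) :=
    (hcont.mono hsub).intervalIntegrable_of_Icc (by linarith)
  have hmono : ∫ _ in a..(a + δ), (|f x| - H * δ ^ θ) ≤ ∫ t in a..(a + δ), |f t| := by
    refine intervalIntegral.integral_mono_on (by linarith) intervalIntegrable_const hint' ?_
    intro t ht
    have htx : |x - t| ≤ δ := abs_le.2 ⟨by linarith [ht.2], by linarith [ht.1]⟩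
    have hpow : H * |x - t| ^ θ ≤ H * δ ^ θ := by gcongr
    linarith [h t (hsub ht) x ⟨hx0, hx1⟩, abs_sub_abs_le_abs_sub (f x) (f t)]
  have hle : ∫ t in a..(a + δ), |f t| ≤ ∫ t in (0 : ℝ)..1, |f t| :=
    intervalIntegral.integral_mono_interval ha0 (by linarith) ha1
      (Filter.Eventually.of_forall fun _ => abs_nonneg _) hint
  rw [intervalIntegral.integral_const, smul_eq_mul, add_sub_cancel_left] at hmono
  linarith

theorem interpolation_sup_holder_L1 (θ : ℝ) (hθ : θ ∈ Set.Ioo (0 : ℝ) 1) :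
    ∃ C : ℝ, 0 < C ∧
      ∀ (f : ℝ → ℝ) (Hf : ℝ),
        (∀ s ∈ Set.Icc (0 : ℝ) 1, ∀ t ∈ Set.Icc (0 : ℝ) 1,
          |f t - f s| ≤ Hf * |t - s| ^ θ) →
        ∀ γ ∈ Set.Ioc (0 : ℝ) 1, ∀ x ∈ Set.Icc (0 : ℝ) 1,
          |f x| ≤ C * (γ * Hf + γ ^ (-(1 / θ)) * ∫ t in (0 : ℝ)..1, |f t|) := by
  have hθ0 : 0 < θ := hθ.1
  refine ⟨1, one_pos, fun f Hf h γ hγ x hx => ?_⟩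
  have hδ0 : 0 < γ ^ (1 / θ) := Real.rpow_pos_of_pos hγ.1 _
  have hδ1 : γ ^ (1 / θ) ≤ 1 := Real.rpow_le_one hγ.1.le hγ.2 (by positivity)
  have hδθ : (γ ^ (1 / θ)) ^ θ = γ := by
    rw [← Real.rpow_mul hγ.1.le, one_div_mul_cancel hθ0.ne', Real.rpow_one]
  have key := mul_abs_le_of_abs_sub_le_mul_rpow hθ0 h ⟨hδ0, hδ1⟩ hx
  rw [hδθ] at key
  rw [Real.rpow_neg hγ.1.le, one_mul]
  refine le_of_mul_le_mul_left (key.trans_eq ?_) hδ0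
  field_simp
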